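/- arXiv:1911.01895 — 2 statements merged into one kernel-verified Lean document; each statement's English description precedes it below -/
import Mathlib

section
/- Let C be a small category and let κ be an uncountable regular cardinal such that ℵ₀ · |C| < κ and κ is sharply larger than ℵ₀ · |C|. Then a simplicial presheaf X : Cᵒᵖ ⥤ SSet is κ-compact (i.e. κ-presentable) in the category of simplicial presheaves if and only if X is κ-small. -/
open CategoryTheory CategoryTheory.Limits Cardinal Opposite

/-- The cardinality of a small category: the sum, over all pairs of objects,
of the cardinalities of the hom-sets. -/
noncomputable def catCard (C : Type) [SmallCategory C] : Cardinal :=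
  Cardinal.mk (Σ (c : C) (c' : C), c ⟶ c')

/-- `κ` is sharply larger than `μ` (written `μ ≪ κ`): for all `κ₀ < κ` and `μ₀ < μ`,
`κ₀ ^ μ₀ < κ`. -/
def SharplyLarger (μ κ : Cardinal) : Prop :=
  ∀ κ₀ < κ, ∀ μ₀ < μ, κ₀ ^ μ₀ < κ

/-- A simplicial presheaf `X : Cᵒᵖ ⥤ SSet` is `κ`-small if the sum, over all objects `c`
of `C` and all `n : ℕ`, of the cardinality of the set of `n`-simplices of `X(c)` is less
than `κ`. -/
def SPshSmall {C : Type} [SmallCategory C] (κ : Cardinal) (X : Cᵒᵖ ⥤ SSet.{0}) : Prop :=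
  Cardinal.mk (Σ (c : C) (n : ℕ), (X.obj (op c)).obj (op (SimplexCategory.mk n))) < κ

/-- A small category `J` is `κ`-filtered if every diagram indexed by a category with
fewer than `κ` morphisms admits a cocone. -/
def IsKappaFiltered (κ : Cardinal) (J : Type) [SmallCategory J] : Prop :=
  ∀ (K : Type) [SmallCategory K], catCard K < κ → ∀ F : K ⥤ J, Nonempty (Cocone F)

/-- An object `X` of a category is `κ`-compact (`κ`-presentable) if `Hom(X, −)`
preserves colimits of all `κ`-filtered shapes. -/
def IsKappaCompact {D : Type u} [Category.{0} D] (κ : Cardinal) (X : D) : Prop :=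
  ∀ (J : Type) [SmallCategory J], IsKappaFiltered κ J →
    Nonempty (PreservesColimitsOfShape J (coyoneda.obj (op X)))

section Cardinality

lemma catCard_lt_iff_hasCardinalLT_arrow (C : Type) [SmallCategory C] (κ : Cardinal) :
    catCard C < κ ↔ HasCardinalLT (Arrow C) κ := by
  rw [hasCardinalLT_iff_of_equiv (Arrow.equivSigma C), hasCardinalLT_iff_cardinal_mk_lt, catCard]

lemma isKappaFiltered_iff_isCardinalFiltered (κ : Cardinal) [Fact κ.IsRegular]
    (J : Type) [SmallCategory J] : IsKappaFiltered κ J ↔ IsCardinalFiltered J κ :=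
  ⟨fun h ↦ ⟨fun F hA ↦ h _ ((catCard_lt_iff_hasCardinalLT_arrow _ _).2 hA) F⟩,
    fun h _ _ hK F ↦ h.nonempty_cocone F ((catCard_lt_iff_hasCardinalLT_arrow _ _).1 hK)⟩

lemma isKappaCompact_iff_isCardinalPresentable {D : Type*} [Category.{0} D]
    (κ : Cardinal.{0}) [Fact κ.IsRegular] (X : D) :
    IsKappaCompact κ X ↔ IsCardinalPresentable X κ :=
  ⟨fun h ↦ ⟨fun J _ hJ ↦ (h J ((isKappaFiltered_iff_isCardinalFiltered κ J).2 hJ)).some⟩,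
    fun _ J _ hJ ↦ by
      have := (isKappaFiltered_iff_isCardinalFiltered κ J).1 hJ
      exact ⟨preservesColimitsOfShape_of_isCardinalPresentable X κ J⟩⟩

instance SimplexCategory.countable_arrow : Countable (Arrow SimplexCategory) := by
  have : Countable SimplexCategory :=
    Function.Injective.countable (f := SimplexCategory.len) (fun _ _ h ↦ SimplexCategory.ext h)
  have (a b : SimplexCategory) : Countable (a ⟶ b) :=
    Function.Injective.countable (f := fun f ↦ (SimplexCategory.Hom.toOrderHom f : Fin _ → Fin _))
      (fun _ _ h ↦ SimplexCategory.Hom.ext _ _ (OrderHom.ext _ _ h))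
  exact (Arrow.equivSigma SimplexCategory).injective.countable

lemma hasCardinalLT_arrow_prod {C D : Type*} [Category* C] [Category* D] {κ : Cardinal}
    (hκ : ℵ₀ ≤ κ) (hC : HasCardinalLT (Arrow C) κ) (hD : HasCardinalLT (Arrow D) κ) :
    HasCardinalLT (Arrow (C × D)) κ :=
  (hasCardinalLT_prod hκ hC hD).of_surjective
    (fun p ↦ Arrow.mk (X := (p.1.left, p.2.left)) (Y := (p.1.right, p.2.right)) (p.1.hom, p.2.hom))
    (fun f ↦ ⟨(Arrow.mk f.hom.1, Arrow.mk f.hom.2), rfl⟩)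

end Cardinality

namespace CategoryTheory.Presheaf

universe u

variable {E : Type u} [SmallCategory E] (X : Eᵒᵖ ⥤ Type u) {κ : Cardinal.{u}}

lemma hasCardinalLT_arrow_costructuredArrow_yoneda [Fact κ.IsRegular]
    (hE : HasCardinalLT (Arrow E) κ) (hX : HasCardinalLT (Σ e, X.obj e) κ) :
    HasCardinalLT (Arrow (CostructuredArrow yoneda X)) κ := by
  have h (f : Arrow E) : HasCardinalLT (yoneda.obj f.right ⟶ X) κ :=
    hX.of_injective (fun g ↦ ⟨op f.right, yonedaEquiv g⟩) (fun g₁ g₂ h ↦ by simpa using h)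
  refine (hasCardinalLT_sigma _ κ hE h).of_surjective
    (fun p ↦ Arrow.mk (CostructuredArrow.homMk p.1.hom :
      CostructuredArrow.mk (yoneda.map p.1.hom ≫ p.2) ⟶ CostructuredArrow.mk p.2)) ?_
  intro f
  obtain ⟨⟨l, ⟨⟨⟩⟩, a⟩, ⟨r, ⟨⟨⟩⟩, b⟩, g⟩ := f
  obtain ⟨g, h, rfl⟩ := CostructuredArrow.homMk_surjective g
  change l ⟶ r at g
  obtain rfl : yoneda.map g ≫ b = a := h
  exact ⟨⟨Arrow.mk g, b⟩, rfl⟩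

/-- A presheaf with fewer than `κ` sections on a category with fewer than `κ` morphisms
is `κ`-presentable. -/
lemma isCardinalPresentable_of_hasCardinalLT [Fact κ.IsRegular]
    (hE : HasCardinalLT (Arrow E) κ) (hX : HasCardinalLT (Σ e, X.obj e) κ) :
    IsCardinalPresentable X κ := by
  have (j : CostructuredArrow yoneda X) :
      IsCardinalPresentable ((CostructuredArrow.proj yoneda X ⋙ yoneda).obj j) κ := by
    let e : coyoneda.obj (op (yoneda.obj j.left)) ≅ (evaluation _ _).obj (op j.left) :=
      NatIso.ofComponents (fun P ↦ Equiv.toIso yonedaEquiv)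
    exact Functor.isCardinalAccessible_of_natIso e.symm κ
  exact isCardinalPresentable_of_isColimit' _ (isColimitTautologicalCocone X) κ
    (hasCardinalLT_arrow_costructuredArrow_yoneda X hE hX)

variable (κ) in
/-- The subpresheaves of `X` with fewer than `κ` sections. -/
abbrev SmallSubfunctor := { S : Subfunctor X // HasCardinalLT (Σ e, S.obj e) κ }

namespace SmallSubfunctor

variable [Fact κ.IsRegular]

instance : IsCardinalFiltered (SmallSubfunctor X κ) κ :=
  isCardinalFiltered_preorder _ _ (fun ι S hι ↦ by
    refine ⟨⟨⨆ i, (S i).1, ?_⟩, fun i ↦ le_iSup (fun i ↦ (S i).1) i⟩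
    refine (hasCardinalLT_sigma (fun i ↦ Σ e, (S i).1.obj e) κ
      (by rwa [hasCardinalLT_iff_cardinal_mk_lt]) (fun i ↦ (S i).2)).of_surjective
      (fun p ↦ ⟨p.2.1, p.2.2.1, ?_⟩) ?_
    · exact le_iSup (fun i ↦ (S i).1) p.1 _ p.2.2.2
    · rintro ⟨e, x, hx⟩
      have hx' := hx
      simp only [Subfunctor.iSup_obj, Set.mem_iUnion] at hx'
      obtain ⟨i, hi⟩ := hx'
      exact ⟨⟨i, e, x, hi⟩, rfl⟩)

instance : IsFiltered (SmallSubfunctor X κ) := isFiltered_of_isCardinalFiltered _ κ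

variable (κ) in
/-- The inclusion of the small subpresheaves of `X` in the category of presheaves. -/
@[simps]
def functor : SmallSubfunctor X κ ⥤ Eᵒᵖ ⥤ Type u where
  obj S := S.1.toFunctor
  map f := Subfunctor.homOfLe (leOfHom f)

variable (κ) in
/-- The cocone with point `X` of all small subpresheaves of `X`. -/
@[simps]
def cocone : Cocone (functor X κ) where
  pt := X
  ι := { app S := S.1.ι }

/-- If `E` has fewer than `κ` morphisms, every presheaf on `E` is the colimit of its
subpresheaves with fewer than `κ` sections. -/
noncomputable def isColimitCocone (hE : HasCardinalLT (Arrow E) κ) :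
    IsColimit (cocone X κ) :=
  evaluationJointlyReflectsColimits _ (fun e ↦ by
    refine Types.FilteredColimit.isColimitOf' _ _ (fun x ↦ ?_) ?_
    · refine ⟨⟨Subfunctor.ofSection (F := X) (X := e) x, ?_⟩,
        ⟨x, Subfunctor.mem_ofSection_obj (F := X) x⟩, rfl⟩
      refine HasCardinalLT.of_surjective (X := { f : Arrow Eᵒᵖ // f.left = e }) ?_
        (fun f ↦ ⟨f.1.right, X.map (eqToHom f.2.symm ≫ f.1.hom) x, _, rfl⟩) ?_
      · exact HasCardinalLT.of_injective (by simpa using hE) _ Subtype.val_injective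
      · rintro ⟨e', _, f, rfl⟩
        exact ⟨⟨Arrow.mk f, rfl⟩, by simp⟩
    · rintro S ⟨x, hx⟩ ⟨y, hy⟩ rfl
      exact ⟨S, 𝟙 _, rfl⟩)

end SmallSubfunctor

lemma hasCardinalLT_of_isCardinalPresentable [Fact κ.IsRegular]
    (hE : HasCardinalLT (Arrow E) κ) [IsCardinalPresentable X κ] :
    HasCardinalLT (Σ e, X.obj e) κ := by
  have := preservesColimitsOfShape_of_isCardinalPresentable X κ (SmallSubfunctor X κ)
  obtain ⟨S, f, hf⟩ : ∃ (S : SmallSubfunctor X κ) (f : X ⟶ S.1.toFunctor), f ≫ S.1.ι = 𝟙 X :=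
    exists_hom_of_preservesColimit_coyoneda (SmallSubfunctor.isColimitCocone X hE) (𝟙 X)
  refine S.2.of_injective (fun x ↦ ⟨x.1, f.app x.1 x.2⟩) ?_
  refine Function.LeftInverse.injective (g := fun y ↦ (⟨y.1, y.2.1⟩ : Σ e, X.obj e)) ?_
  rintro ⟨e, x⟩
  have h : (f.app e x).1 = x := by
    simpa using ConcreteCategory.congr_hom (NatTrans.congr_app hf e) x
  exact congrArg (Sigma.mk e) h

/-- On a category with fewer than `κ` morphisms, the `κ`-presentable presheaves are those
with fewer than `κ` sections. -/
lemma isCardinalPresentable_iff_hasCardinalLT [Fact κ.IsRegular]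
    (hE : HasCardinalLT (Arrow E) κ) :
    IsCardinalPresentable X κ ↔ HasCardinalLT (Σ e, X.obj e) κ :=
  ⟨fun _ ↦ hasCardinalLT_of_isCardinalPresentable X hE,
    isCardinalPresentable_of_hasCardinalLT X hE⟩

end CategoryTheory.Presheaf

/-- Simplicial presheaves on `C` are presheaves of types on `C × SimplexCategory`. -/
def simplicialPresheafEquivalence (C : Type) [SmallCategory C] :
    (Cᵒᵖ ⥤ SSet.{0}) ≌ ((C × SimplexCategory)ᵒᵖ ⥤ Type) :=
  (Functor.currying (C := Cᵒᵖ) (D := SimplexCategoryᵒᵖ) (E := Type)).trans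
    (prodOpEquiv C (D := SimplexCategory)).symm.congrLeft

lemma sPshSmall_iff_hasCardinalLT {C : Type} [SmallCategory C] (κ : Cardinal)
    (X : Cᵒᵖ ⥤ SSet.{0}) :
    SPshSmall κ X ↔
      HasCardinalLT (Σ e, ((simplicialPresheafEquivalence C).functor.obj X).obj e) κ := by
  rw [SPshSmall, ← hasCardinalLT_iff_cardinal_mk_lt]
  exact hasCardinalLT_iff_of_equiv
    { toFun x := ⟨op (x.1, SimplexCategory.mk x.2.1), x.2.2⟩
      invFun y := ⟨y.1.unop.1, y.1.unop.2.len, y.2⟩ } κ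

/-- Lemma 3.1(a) of the paper for simplicial presheaves over an ordinary small category:
for `κ` an uncountable regular cardinal with `ℵ₀ · |C| < κ` and `ℵ₀ · |C| ≪ κ`, a simplicial
presheaf is `κ`-compact iff it is `κ`-small. -/
theorem sPsh_compact_iff_small (C : Type) [SmallCategory C] (κ : Cardinal)
    (hreg : κ.IsRegular) (huncount : ℵ₀ < κ) (hlt : ℵ₀ * catCard C < κ)
    (hsharp : SharplyLarger (ℵ₀ * catCard C) κ) (X : Cᵒᵖ ⥤ SSet.{0}) :
    IsKappaCompact κ X ↔ SPshSmall κ X := by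
  have : Fact κ.IsRegular := ⟨hreg⟩
  have hC : HasCardinalLT (Arrow C) κ := (catCard_lt_iff_hasCardinalLT_arrow C κ).1
    ((Cardinal.le_mul_left aleph0_ne_zero).trans_lt hlt)
  have hΔ : HasCardinalLT (Arrow SimplexCategory) κ := by
    rw [hasCardinalLT_iff_cardinal_mk_lt]
    exact mk_le_aleph0.trans_lt huncount
  rw [isKappaCompact_iff_isCardinalPresentable, sPshSmall_iff_hasCardinalLT,
    ← Presheaf.isCardinalPresentable_iff_hasCardinalLT _
      (hasCardinalLT_arrow_prod huncount.le hC hΔ),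
    isCardinalPresentable_iff_of_isEquivalence]
end

section
/- Let C and D be small categories, let F : (Cᵒᵖ ⥤ Type) ⥤ (Dᵒᵖ ⥤ Type) be a functor admitting a right adjoint G : (Dᵒᵖ ⥤ Type) ⥤ (Cᵒᵖ ⥤ Type), and let κ be an inaccessible cardinal with |C| · |D| < κ and κ sharply larger than |C| · |D|. If F sends every κ-small presheaf to a κ-small presheaf, then G preserves κ-small morphisms: for every κ-small morphism f : X ⟶ Y in Dᵒᵖ ⥤ Type, the morphism G(f) : G(X) ⟶ G(Y) is κ-small in Cᵒᵖ ⥤ Type. -/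
open CategoryTheory CategoryTheory.Limits Cardinal Opposite

/-- A presheaf `X : Cᵒᵖ ⥤ Type` is `κ`-small if the sum over all objects `c` of the
cardinality of `X(c)` is less than `κ`. -/
def PshSmall {C : Type} [SmallCategory C] (κ : Cardinal) (X : Cᵒᵖ ⥤ Type) : Prop :=
  Cardinal.mk (Σ c : C, X.obj (op c)) < κ

/-- A morphism `f : X ⟶ Y` of presheaves is `κ`-small if every pullback of it along a map
with `κ`-small domain has `κ`-small domain. -/
def MapSmall {C : Type} [SmallCategory C] (κ : Cardinal) {X Y : Cᵒᵖ ⥤ Type} (f : X ⟶ Y) :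
    Prop :=
  ∀ (Z : Cᵒᵖ ⥤ Type) (g : Z ⟶ Y), PshSmall κ Z → PshSmall κ (pullback g f)

/-- A natural transformation is determined by its action on the total set of elements. -/
theorem mk_hom_le_power {D : Type} [SmallCategory D] (A B : Dᵒᵖ ⥤ Type) :
    #(A ⟶ B) ≤ #(Σ d : D, B.obj (op d)) ^ #(Σ d : D, A.obj (op d)) := by
  rw [Cardinal.power_def]
  refine Cardinal.mk_le_of_injective
    (f := fun (φ : A ⟶ B) a => (⟨a.1, φ.app (op a.1) a.2⟩ : Σ d : D, B.obj (op d))) ?_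
  intro φ ψ h
  ext d a
  have h' := congrFun h ⟨d.unop, a⟩
  simpa using h'

theorem power_lt_of_isInaccessible {κ a b : Cardinal} (hκ : κ.IsInaccessible)
    (ha : a < κ) (hb : b < κ) : a ^ b < κ :=
  calc a ^ b ≤ (2 ^ a) ^ b := Cardinal.power_le_power_right (Cardinal.cantor a).le
    _ = 2 ^ (a * b) := (Cardinal.power_mul).symm
    _ < κ := hκ.isStrongLimit.isStrongPrelimit (Cardinal.mul_lt_of_lt hκ.aleph0_lt.le ha hb)

/-- Over an inaccessible cardinal, small presheaves have a small set of morphisms. -/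
theorem PshSmall.mk_hom_lt {D : Type} [SmallCategory D] {κ : Cardinal} (hκ : κ.IsInaccessible)
    {A B : Dᵒᵖ ⥤ Type} (hA : PshSmall κ A) (hB : PshSmall κ B) : #(A ⟶ B) < κ :=
  (mk_hom_le_power A B).trans_lt (power_lt_of_isInaccessible hκ hB hA)

theorem mk_sigma_hom_le_catCard {C : Type} [SmallCategory C] (c : C) :
    #(Σ c' : C, (yoneda.obj c).obj (op c')) ≤ catCard C := by
  refine Cardinal.mk_le_of_injective
    (f := fun p => (⟨p.1, c, p.2⟩ : Σ (a : C) (b : C), a ⟶ b)) ?_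
  rintro ⟨a, u⟩ ⟨b, v⟩ h
  obtain ⟨rfl, h⟩ := Sigma.mk.inj h
  simpa using h

theorem one_le_catCard (D : Type) [SmallCategory D] [Nonempty D] : 1 ≤ catCard D := by
  obtain ⟨d⟩ := ‹Nonempty D›
  have : Nonempty (Σ (a : D) (b : D), a ⟶ b) := ⟨⟨d, d, 𝟙 d⟩⟩
  exact Cardinal.one_le_iff_ne_zero.2 (Cardinal.mk_ne_zero _)

/-- A presheaf with a map to a small one is small as soon as its fibers are. -/
theorem PshSmall.of_fiber {C : Type} [SmallCategory C] {κ : Cardinal} (hκ : κ.IsRegular)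
    {P Z : Cᵒᵖ ⥤ Type} (p : P ⟶ Z) (hZ : PshSmall κ Z)
    (h : ∀ (c : C) (z : Z.obj (op c)), #{x : P.obj (op c) // p.app (op c) x = z} < κ) :
    PshSmall κ P := by
  have e : (Σ c : C, P.obj (op c)) ≃
      Σ q : (Σ c : C, Z.obj (op c)), {x : P.obj (op q.1) // p.app (op q.1) x = q.2} :=
    (Equiv.sigmaCongrRight fun c => (Equiv.sigmaFiberEquiv (p.app (op c))).symm).trans
      (Equiv.sigmaAssoc fun (c : C) (z : Z.obj (op c)) =>
        {x : P.obj (op c) // p.app (op c) x = z}).symm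
  rw [PshSmall, Cardinal.mk_congr e, Cardinal.mk_sigma]
  exact Cardinal.sum_lt_of_isRegular hκ hZ fun q => h q.1 q.2

/-- Transposing along `F ⊣ G`, the fiber of a pullback of `G.map f` over an element `z` at `c`
embeds into the maps from `F` of the representable at `c` to a pullback of `f`. -/
theorem mk_fiber_pullback_le {C D : Type} [SmallCategory C] [SmallCategory D]
    {F : (Cᵒᵖ ⥤ Type) ⥤ (Dᵒᵖ ⥤ Type)} {G : (Dᵒᵖ ⥤ Type) ⥤ (Cᵒᵖ ⥤ Type)} (adj : F ⊣ G)
    {X Y : Dᵒᵖ ⥤ Type} (f : X ⟶ Y) {Z : Cᵒᵖ ⥤ Type} (g : Z ⟶ G.obj Y)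
    (c : C) (z : Z.obj (op c)) :
    #{x : (pullback g (G.map f)).obj (op c) //
        (pullback.fst g (G.map f)).app (op c) x = z} ≤
      #(F.obj (yoneda.obj c) ⟶
        pullback ((adj.homEquiv _ _).symm (yonedaEquiv.symm z ≫ g)) f) := by
  have key (x : {x : (pullback g (G.map f)).obj (op c) //
      (pullback.fst g (G.map f)).app (op c) x = z}) :
      yonedaEquiv.symm x.1 ≫ pullback.fst g (G.map f) = yonedaEquiv.symm z := by
    apply yonedaEquiv.injective
    rw [yonedaEquiv_comp, Equiv.apply_symm_apply, Equiv.apply_symm_apply, x.2]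
  refine Cardinal.mk_le_of_injective (f := fun x => pullback.lift (𝟙 _)
    ((adj.homEquiv _ _).symm (yonedaEquiv.symm x.1 ≫ pullback.snd g (G.map f))) ?_) ?_
  · rw [Category.id_comp, ← Adjunction.homEquiv_naturality_right_symm, ← key x,
      Category.assoc, Category.assoc, pullback.condition]
  · intro x y h
    have h' := congrArg (· ≫ pullback.snd _ f) h
    simp only [pullback.lift_snd] at h'
    apply Subtype.ext
    apply yonedaEquiv.symm.injective
    apply pullback.hom_ext
    · rw [key x, key y]
    · exact (adj.homEquiv _ _).symm.injective h'

/-- Lemma 3.2 of the paper (set-valued presheaf form, second alternative hypothesis):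
if `F ⊣ G` and `F` preserves `κ`-small presheaves, then for `κ` inaccessible with
`|C| · |D| < κ` and `|C| · |D| ≪ κ`, the right adjoint `G` preserves `κ`-small morphisms. -/
theorem rightAdjoint_preserves_small_maps_of_inaccessible
    (C D : Type) [SmallCategory C] [SmallCategory D]
    (F : (Cᵒᵖ ⥤ Type) ⥤ (Dᵒᵖ ⥤ Type)) (G : (Dᵒᵖ ⥤ Type) ⥤ (Cᵒᵖ ⥤ Type)) (adj : F ⊣ G)
    (κ : Cardinal) (hinacc : κ.IsInaccessible)
    (hlt : catCard C * catCard D < κ) (hsharp : SharplyLarger (catCard C * catCard D) κ)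
    (hF : ∀ X : Cᵒᵖ ⥤ Type, PshSmall κ X → PshSmall κ (F.obj X))
    {X Y : Dᵒᵖ ⥤ Type} (f : X ⟶ Y) (hf : MapSmall κ f) :
    MapSmall κ (G.map f) := by
  have hyoneda (c : C) : PshSmall κ (F.obj (yoneda.obj c)) := by
    rcases isEmpty_or_nonempty D with hD | hD
    · rw [PshSmall, Cardinal.mk_eq_zero]
      exact hinacc.pos
    · refine hF _ ((mk_sigma_hom_le_catCard c).trans_lt (lt_of_le_of_lt ?_ hlt))
      exact le_mul_of_one_le_right' (one_le_catCard D)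
  intro Z g hZ
  refine PshSmall.of_fiber hinacc.isRegular (pullback.fst g (G.map f)) hZ fun c z => ?_
  exact (mk_fiber_pullback_le adj f g c z).trans_lt
    ((hyoneda c).mk_hom_lt hinacc (hf _ _ (hyoneda c)))
end
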